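/- arXiv:2506.15317 — 4 statements merged into one kernel-verified Lean document; each statement's English description precedes it below -/
import Mathlib

section
/- Let r₀ > 0, let k be an integer, and let f : [r₀,∞) → ℝ be a smooth function that vanishes for all sufficiently large r. Then ∫_{r₀}^∞ ( f'(r)² + (k²/r²) f(r)² ) r dr − |k| f(r₀)² = ∫_{r₀}^∞ ( f'(r) + (|k|/r) f(r) )² r dr. -/
open MeasureTheory Set

/-- A function continuous on `[a, ∞)` and vanishing for all large arguments is integrable
on `(a, ∞)`. -/
theorem integrableOn_Ioi_of_continuousOn_of_eventually_zero {g : ℝ → ℝ} {a R : ℝ}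
    (hg : ContinuousOn g (Ici a)) (hR : ∀ r > R, g r = 0) : IntegrableOn g (Ioi a) := by
  have hcompact : IntegrableOn g (Icc a R) :=
    (hg.mono Icc_subset_Ici_self).integrableOn_compact isCompact_Icc
  refine hcompact.of_forall_sdiff_eq_zero measurableSet_Ioi fun x hx => hR x ?_
  by_contra! h
  exact hx.2 ⟨le_of_lt hx.1, h⟩

/-- Completing the square: for smooth `f` vanishing for all sufficiently large `r`,
`∫_{r₀}^∞ (f'² + (k²/r²) f²) r dr − |k| f(r₀)² = ∫_{r₀}^∞ (f' + (|k|/r) f)² r dr`. -/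
theorem stmt_2 (r₀ : ℝ) (hr₀ : 0 < r₀) (k : ℤ) (f : ℝ → ℝ)
    (hf : ContDiff ℝ (⊤ : ℕ∞) f) (hvan : ∃ R : ℝ, ∀ r ≥ R, f r = 0) :
    (∫ r in Ioi r₀, ((deriv f r) ^ 2 + ((k : ℝ) ^ 2 / r ^ 2) * f r ^ 2) * r)
        - (|k| : ℝ) * f r₀ ^ 2 =
      ∫ r in Ioi r₀, (deriv f r + ((|k| : ℝ) / r) * f r) ^ 2 * r := by
  obtain ⟨R, hR⟩ := hvan
  have hderiv_zero : ∀ r > R, deriv f r = 0 := fun r hr => by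
    have h : f =ᶠ[nhds r] fun _ => 0 :=
      (eventually_gt_nhds hr).mono fun x hx => hR x (le_of_lt hx)
    simp [h.deriv_eq]
  have hf_cont : Continuous f := hf.continuous
  have hderiv_cont : Continuous (deriv f) := hf.continuous_deriv (by simp)
  have hint_energy : IntegrableOn
      (fun r => ((deriv f r) ^ 2 + ((k : ℝ) ^ 2 / r ^ 2) * f r ^ 2) * r) (Ioi r₀) := by
    refine integrableOn_Ioi_of_continuousOn_of_eventually_zero (R := R) ?_ fun r hr => by
      simp [hderiv_zero r hr, hR r hr.le]
    have hne : ∀ r ∈ Ici r₀, r ^ 2 ≠ 0 := fun r hr => pow_ne_zero 2 (hr₀.trans_le hr).ne'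
    exact ((hderiv_cont.pow 2).continuousOn.add
      ((continuousOn_const.div (continuous_pow 2).continuousOn hne).mul
        (hf_cont.pow 2).continuousOn)).mul continuousOn_id
  have hint_cross : IntegrableOn (fun r => |(k : ℝ)| * (2 * f r * deriv f r)) (Ioi r₀) :=
    integrableOn_Ioi_of_continuousOn_of_eventually_zero (R := R) (by fun_prop) fun r hr => by
      simp [hderiv_zero r hr]
  have hcross : ∫ r in Ioi r₀, |(k : ℝ)| * (2 * f r * deriv f r) =
      0 - |(k : ℝ)| * f r₀ ^ 2 := by
    refine integral_Ioi_of_hasDerivAt_of_tendsto' (f := fun r => |(k : ℝ)| * f r ^ 2)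
      (fun r _ => ?_) hint_cross ?_
    · simpa using ((hf.differentiable (by simp) r).hasDerivAt.pow 2).const_mul |(k : ℝ)|
    · refine tendsto_const_nhds.congr' ?_
      filter_upwards [Filter.eventually_ge_atTop R] with r hr
      simp [hR r hr]
  rw [sub_eq_add_neg, ← zero_sub, ← hcross, ← integral_add hint_energy hint_cross]
  refine setIntegral_congr_fun measurableSet_Ioi fun r hr => ?_
  have hr : r ≠ 0 := (hr₀.trans hr).ne'
  simp only [← sq_abs (k : ℝ)]
  field_simp
  ring
end

section
/- Let r₀ > 0, let k be an integer, and let f : [r₀,∞) → ℝ be a smooth function that vanishes for all sufficiently large r. Then the trace inequality |k| f(r₀)² ≤ ∫_{r₀}^∞ ( f'(r)² + (k²/r²) f(r)² ) r dr holds. -/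
open MeasureTheory Set

/-- A function that is continuous on `[a, ∞)` and vanishes on `(b, ∞)` is integrable on
`(a, ∞)`. -/
lemma integrableOn_Ioi_of_continuousOn_of_eqOn_zero {g : ℝ → ℝ} {a b : ℝ}
    (hg : ContinuousOn g (Ici a)) (hzero : EqOn g 0 (Ioi b)) : IntegrableOn g (Ioi a) := by
  have hcompact : IntegrableOn g (Icc a b) :=
    (hg.mono Icc_subset_Ici_self).integrableOn_Icc
  have htail : IntegrableOn g (Ioi b) :=
    integrableOn_zero.congr_fun hzero.symm measurableSet_Ioi
  refine (hcompact.union htail).mono_set fun x hx => ?_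
  rcases le_or_gt x b with h | h
  · exact Or.inl ⟨le_of_lt hx, h⟩
  · exact Or.inr h

/-- Trace inequality: for smooth `f` vanishing for all sufficiently large `r`,
`|k| f(r₀)² ≤ ∫_{r₀}^∞ (f'² + (k²/r²) f²) r dr`. -/
theorem stmt_3 (r₀ : ℝ) (hr₀ : 0 < r₀) (k : ℤ) (f : ℝ → ℝ)
    (hf : ContDiff ℝ (⊤ : ℕ∞) f) (hvan : ∃ R : ℝ, ∀ r ≥ R, f r = 0) :
    (|k| : ℝ) * f r₀ ^ 2 ≤
      ∫ r in Ioi r₀, ((deriv f r) ^ 2 + ((k : ℝ) ^ 2 / r ^ 2) * f r ^ 2) * r := by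
  obtain ⟨R, hR⟩ := hvan
  have hdiff : Differentiable ℝ f := hf.differentiable (by simp)
  have hcf : Continuous f := hf.continuous
  have hcd : Continuous (deriv f) := hf.continuous_deriv (by exact_mod_cast le_top)
  have hd0 : ∀ r ∈ Ioi R, deriv f r = 0 := fun r hr => by
    have h : f =ᶠ[nhds r] fun _ => 0 := by
      filter_upwards [Ioi_mem_nhds hr] with x hx using hR x (le_of_lt hx)
    simp [h.deriv_eq]
  have hintRight : IntegrableOn
      (fun r => ((deriv f r) ^ 2 + ((k : ℝ) ^ 2 / r ^ 2) * f r ^ 2) * r) (Ioi r₀) := by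
    refine integrableOn_Ioi_of_continuousOn_of_eqOn_zero (b := R) ?_ fun r hr => ?_
    · have hne : ∀ r ∈ Ici r₀, r ^ 2 ≠ 0 := fun r hr => pow_ne_zero 2 (hr₀.trans_le hr).ne'
      fun_prop (disch := assumption)
    · simp [hd0 r hr, hR r (le_of_lt hr)]
  have hintLeft : IntegrableOn (fun r => -|(k : ℝ)| * (2 * f r * deriv f r)) (Ioi r₀) := by
    refine integrableOn_Ioi_of_continuousOn_of_eqOn_zero (b := R) (by fun_prop) fun r hr => ?_
    simp [hd0 r hr]
  have hderiv : ∀ r ∈ Ici r₀,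
      HasDerivAt (fun r => -|(k : ℝ)| * f r ^ 2) (-|(k : ℝ)| * (2 * f r * deriv f r)) r :=
    fun r _ => by simpa using ((hdiff r).hasDerivAt.pow 2).const_mul (-|(k : ℝ)|)
  have hlim : Filter.Tendsto (fun r => -|(k : ℝ)| * f r ^ 2) Filter.atTop (nhds 0) := by
    refine tendsto_const_nhds.congr' ?_
    filter_upwards [Filter.eventually_ge_atTop R] with r hr
    simp [hR r hr]
  have hftc := integral_Ioi_of_hasDerivAt_of_tendsto' hderiv hintLeft hlim
  calc (|k| : ℝ) * f r₀ ^ 2 = ∫ r in Ioi r₀, -|(k : ℝ)| * (2 * f r * deriv f r) := by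
        rw [hftc]; ring
    _ ≤ _ := by
      refine setIntegral_mono_on hintLeft hintRight measurableSet_Ioi fun r hr => ?_
      have hpos : 0 < r := hr₀.trans hr
      have hsq : ((deriv f r) ^ 2 + ((k : ℝ) ^ 2 / r ^ 2) * f r ^ 2) * r
          - -|(k : ℝ)| * (2 * f r * deriv f r) = (deriv f r + |(k : ℝ)| / r * f r) ^ 2 * r := by
        rw [← sq_abs (k : ℝ)]
        field_simp
        ring
      have : 0 ≤ (deriv f r + |(k : ℝ)| / r * f r) ^ 2 * r := by positivity
      linarith
end

section
/- Let r₀ > 0, let k be an integer, and let f : [r₀,∞) → ℝ be a smooth function that vanishes for all sufficiently large r and satisfies the Robin boundary condition r₀ f'(r₀) + |k| f(r₀) = 0. If ∫_{r₀}^∞ (Δ_k f)(r) f(r) r dr = 0, then f is identically zero on [r₀,∞). Consequently the quadratic form of Δ_k with the Robin boundary condition is strictly negative on nonzero such functions. -/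
open MeasureTheory Set

/-- The radial operator `Δ_k f(r) = (1/r) (d/dr)(r f'(r)) − (k²/r²) f(r)`. -/
noncomputable def Δk (k : ℤ) (f : ℝ → ℝ) (r : ℝ) : ℝ :=
  (1 / r) * deriv (fun s => s * deriv f s) r - ((k : ℝ) ^ 2 / r ^ 2) * f r

/-- The Robin operator `r f'(r) + |k| f(r)`. -/
noncomputable def robin (k : ℤ) (f : ℝ → ℝ) (r : ℝ) : ℝ :=
  r * deriv f r + |(k : ℝ)| * f r

lemma continuous_robin (k : ℤ) {f : ℝ → ℝ} (hf : ContDiff ℝ (⊤ : ℕ∞) f) :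
    Continuous (robin k f) := by
  have h1 := hf.continuous
  have h2 : Continuous (deriv f) := hf.continuous_deriv (by simp)
  unfold robin
  fun_prop

/-- The integrand of the quadratic form is an exact derivative minus a weighted square. -/
lemma hasDerivAt_mul_robin (k : ℤ) {f : ℝ → ℝ} (hf : ContDiff ℝ (⊤ : ℕ∞) f) {r : ℝ}
    (hr : r ≠ 0) :
    HasDerivAt (fun s => f s * robin k f s)
      (Δk k f r * f r * r + robin k f r ^ 2 / r) r := by
  have h1 : HasDerivAt f (deriv f r) r := (hf.differentiable (by simp) r).hasDerivAt
  have hd : ContDiff ℝ (⊤ : ℕ∞) (deriv f) := (contDiff_infty_iff_deriv.mp hf).2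
  have h2 : HasDerivAt (fun s => s * deriv f s) (deriv (fun s => s * deriv f s) r) r :=
    ((contDiff_id.mul hd).differentiable (by simp) r).hasDerivAt
  refine (h1.mul (h2.add (h1.const_mul |(k : ℝ)|))).congr_deriv ?_
  simp only [Δk, robin, Pi.add_apply]
  field_simp
  linear_combination -f r ^ 2 * sq_abs (k : ℝ)

/-- A solution of the first order equation `r f' + |k| f = 0` which vanishes at one end of an
interval of positive numbers vanishes on the interval. -/
lemma eq_zero_of_robin_eq_zero (k : ℤ) {f : ℝ → ℝ} (hf : Differentiable ℝ f) {a b : ℝ}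
    (ha : 0 < a) (h : ∀ r ∈ Icc a b, robin k f r = 0) (hb : f b = 0) :
    ∀ r ∈ Icc a b, f r = 0 := by
  intro r hr
  have key : ∀ x ∈ Icc a b, HasDerivAt (fun s => s ^ k.natAbs * f s) 0 x := by
    intro x hx
    have hx0 : 0 < x := ha.trans_le hx.1
    refine ((hasDerivAt_pow k.natAbs x).mul (hf x).hasDerivAt).congr_deriv ?_
    have hg := h x hx
    rw [robin, ← Int.cast_abs, Int.abs_eq_natAbs, Int.cast_natCast] at hg
    rcases Nat.eq_zero_or_eq_succ_pred k.natAbs with hn | hn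
    · rw [hn] at hg ⊢
      simpa [hx0.ne', eq_comm] using hg
    · rw [hn] at hg ⊢
      simp only [Nat.succ_eq_add_one, Nat.add_sub_cancel, pow_succ] at hg ⊢
      linear_combination x ^ k.natAbs.pred * hg
  have hc := constant_of_has_deriv_right_zero
    (fun x hx => (key x hx).continuousAt.continuousWithinAt)
    (fun x hx => (key x (Ico_subset_Icc_self hx)).hasDerivWithinAt)
  have hrb := (hc r hr).trans (hc b ⟨hr.1.trans hr.2, le_rfl⟩).symm
  simpa [hb, (ha.trans_le hr.1).ne'] using hrb

/-- The quadratic form of `Δ_k` with the Robin condition is minus a weighted square norm. -/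
lemma integral_Δk_mul_self (k : ℤ) {f : ℝ → ℝ} (hf : ContDiff ℝ (⊤ : ℕ∞) f) {a b : ℝ}
    (ha : 0 < a) (hab : a ≤ b) (hvan : ∀ r ≥ b, f r = 0) (hrob : robin k f a = 0) :
    ∫ r in Ioi a, Δk k f r * f r * r = -∫ r in a..b, robin k f r ^ 2 / r := by
  have hpos : ∀ x ∈ uIcc a b, x ≠ 0 := fun x hx => by
    rw [uIcc_of_le hab] at hx
    exact (ha.trans_le hx.1).ne'
  have hd : ContDiff ℝ (⊤ : ℕ∞) (deriv f) := (contDiff_infty_iff_deriv.mp hf).2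
  have hc : Continuous (deriv fun s => s * deriv f s) :=
    (contDiff_id.mul hd).continuous_deriv (by simp)
  have hfc := hf.continuous
  have hi1 : IntervalIntegrable (fun r => Δk k f r * f r * r) volume a b := by
    refine ContinuousOn.intervalIntegrable ?_
    unfold Δk
    have h2 : ∀ x ∈ uIcc a b, x ^ 2 ≠ 0 := fun x hx => pow_ne_zero 2 (hpos x hx)
    fun_prop (disch := assumption)
  have hi2 : IntervalIntegrable (fun r => robin k f r ^ 2 / r) volume a b :=
    (((continuous_robin k hf).pow 2).continuousOn.div continuousOn_id hpos).intervalIntegrable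
  have hftc := intervalIntegral.integral_eq_sub_of_hasDerivAt
    (fun x hx => hasDerivAt_mul_robin k hf (hpos x hx)) (hi1.add hi2)
  rw [intervalIntegral.integral_add hi1 hi2, hvan b le_rfl, hrob] at hftc
  have hset : ∫ r in Ioi a, Δk k f r * f r * r = ∫ r in a..b, Δk k f r * f r * r := by
    rw [intervalIntegral.integral_of_le hab]
    refine setIntegral_eq_of_subset_of_forall_sdiff_eq_zero measurableSet_Ioi
      Ioc_subset_Ioi_self fun x hx => ?_
    have hx' : b < x := by
      by_contra! hxb
      exact hx.2 ⟨hx.1, hxb⟩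
    simp [hvan x hx'.le]
  rw [hset]
  linarith

/-- Strict negativity of the quadratic form of `Δ_k` with the Robin boundary
condition `r₀ f'(r₀) + |k| f(r₀) = 0`: if `∫_{r₀}^∞ (Δ_k f) f r dr = 0` then `f ≡ 0`
on `[r₀,∞)`; consequently the form is strictly negative on nonzero functions. -/
theorem stmt_5 (r₀ : ℝ) (hr₀ : 0 < r₀) (k : ℤ) (f : ℝ → ℝ)
    (hf : ContDiff ℝ (⊤ : ℕ∞) f) (hvan : ∃ R : ℝ, ∀ r ≥ R, f r = 0)
    (hrob : r₀ * deriv f r₀ + (|k| : ℝ) * f r₀ = 0) :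
    ((∫ r in Ioi r₀, Δk k f r * f r * r) = 0 → ∀ r ∈ Ici r₀, f r = 0)
      ∧ ((∃ r ∈ Ici r₀, f r ≠ 0) → (∫ r in Ioi r₀, Δk k f r * f r * r) < 0) := by
  have hneg : (∃ r ∈ Ici r₀, f r ≠ 0) → (∫ r in Ioi r₀, Δk k f r * f r * r) < 0 := by
    rintro ⟨r, hr, hfr⟩
    obtain ⟨R, hR⟩ := hvan
    obtain ⟨b, hab, hRb⟩ : ∃ b, r₀ < b ∧ R ≤ b :=
      ⟨max R r₀ + 1, by linarith [le_max_right R r₀], by linarith [le_max_left R r₀]⟩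
    have hb : ∀ x ≥ b, f x = 0 := fun x hx => hR x (hRb.trans hx)
    rw [integral_Δk_mul_self k hf hr₀ hab.le hb hrob, neg_lt_zero]
    have hrb : r ≤ b := by
      by_contra! h
      exact hfr (hb r h.le)
    obtain ⟨c, hc, hgc⟩ : ∃ c ∈ Icc r₀ b, robin k f c ≠ 0 := by
      by_contra! h
      exact hfr (eq_zero_of_robin_eq_zero k (hf.differentiable (by simp)) hr₀ h (hb b le_rfl)
        r ⟨hr, hrb⟩)
    refine intervalIntegral.integral_pos hab
      (((continuous_robin k hf).pow 2).continuousOn.div continuousOn_id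
        fun x hx => (hr₀.trans_le hx.1).ne')
      (fun x hx => div_nonneg (sq_nonneg _) (hr₀.trans hx.1).le)
      ⟨c, hc, div_pos (by positivity) (hr₀.trans_le hc.1)⟩
  refine ⟨fun h r hr => ?_, hneg⟩
  by_contra hfr
  exact (hneg ⟨r, hr, hfr⟩).ne h
end

section
/- Let r₀ > 0, let k ≥ 0 be an integer, and let w be a smooth real-valued function on the closed exterior of the disk {x ∈ ℝ² : |x| ≥ r₀} that vanishes outside a compact set, with angular Fourier coefficients w_k(r) = (1/2π) ∫₀^{2π} w(r cos φ, r sin φ) e^{−ikφ} dφ. Writing z = x₁ + i x₂, the complex-valued integral of the Laplacian against z^{−k} satisfies ∫_{|x|>r₀} Δw(x) / z^k dx = − 2π r₀^{−k} ( r₀ w_k'(r₀) + k w_k(r₀) ). -/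
open MeasureTheory Set

/-- The two-dimensional Laplacian `Δw = ∂²w/∂x₁² + ∂²w/∂x₂²`. -/
noncomputable def lap2 (w : ℝ × ℝ → ℝ) (x : ℝ × ℝ) : ℝ :=
  fderiv ℝ (fun y => fderiv ℝ w y ((1 : ℝ), (0 : ℝ))) x ((1 : ℝ), (0 : ℝ))
    + fderiv ℝ (fun y => fderiv ℝ w y ((0 : ℝ), (1 : ℝ))) x ((0 : ℝ), (1 : ℝ))

/-- The `k`-th angular Fourier coefficient of a function on `ℝ²`:
`w_k(r) = (1/2π) ∫₀^{2π} w(r cos φ, r sin φ) e^{−ikφ} dφ`. -/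
noncomputable def fourierCoef (w : ℝ × ℝ → ℝ) (k : ℤ) (r : ℝ) : ℂ :=
  (1 / (2 * Real.pi)) * ∫ φ in (0 : ℝ)..(2 * Real.pi),
    (w (r * Real.cos φ, r * Real.sin φ) : ℂ) * Complex.exp (-Complex.I * (k : ℂ) * (φ : ℂ))

/-- Derivative of `u (r cos φ, r sin φ)` in the radius. -/
theorem hasDerivAt_comp_polar_radius {u : ℝ × ℝ → ℝ} (hu : Differentiable ℝ u) (r φ : ℝ) :
    HasDerivAt (fun t => u (t * Real.cos φ, t * Real.sin φ))
      (Real.cos φ * fderiv ℝ u (r * Real.cos φ, r * Real.sin φ) (1, 0)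
        + Real.sin φ * fderiv ℝ u (r * Real.cos φ, r * Real.sin φ) (0, 1)) r := by
  have h1 : HasDerivAt (fun t : ℝ => (t * Real.cos φ, t * Real.sin φ))
      (Real.cos φ, Real.sin φ) r := by
    simpa using! ((hasDerivAt_id r).mul_const (Real.cos φ)).prodMk
      ((hasDerivAt_id r).mul_const (Real.sin φ))
  have h2 := (hu (r * Real.cos φ, r * Real.sin φ)).hasFDerivAt.comp_hasDerivAt r h1
  refine h2.congr_deriv ?_
  have : ((Real.cos φ, Real.sin φ) : ℝ × ℝ)
      = Real.cos φ • ((1 : ℝ), (0 : ℝ)) + Real.sin φ • ((0 : ℝ), (1 : ℝ)) := by simp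
  rw [this, map_add, map_smul, map_smul, smul_eq_mul, smul_eq_mul]

/-- Derivative of `u (r cos φ, r sin φ)` in the angle. -/
theorem hasDerivAt_comp_polar_angle {u : ℝ × ℝ → ℝ} (hu : Differentiable ℝ u) (r φ : ℝ) :
    HasDerivAt (fun t => u (r * Real.cos t, r * Real.sin t))
      (r * (-Real.sin φ * fderiv ℝ u (r * Real.cos φ, r * Real.sin φ) (1, 0)
        + Real.cos φ * fderiv ℝ u (r * Real.cos φ, r * Real.sin φ) (0, 1))) φ := by
  have h1 : HasDerivAt (fun t : ℝ => (r * Real.cos t, r * Real.sin t))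
      (r * -Real.sin φ, r * Real.cos φ) φ :=
    ((Real.hasDerivAt_cos φ).const_mul r).prodMk ((Real.hasDerivAt_sin φ).const_mul r)
  have h2 := (hu (r * Real.cos φ, r * Real.sin φ)).hasFDerivAt.comp_hasDerivAt φ h1
  refine h2.congr_deriv ?_
  have : ((r * -Real.sin φ, r * Real.cos φ) : ℝ × ℝ)
      = (r * -Real.sin φ) • ((1 : ℝ), (0 : ℝ)) + (r * Real.cos φ) • ((0 : ℝ), (1 : ℝ)) := by simp
  rw [this, map_add, map_smul, map_smul, smul_eq_mul, smul_eq_mul]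
  ring

/-- The function `z⁻ᵏ` in polar coordinates. -/
noncomputable def polarInvPow (k : ℕ) (p : ℝ × ℝ) : ℂ :=
  ((p.1 : ℂ) ^ k)⁻¹ * Complex.exp (-Complex.I * k * p.2)

theorem polarInvPow_eq (k : ℕ) (r φ : ℝ) :
    polarInvPow k (r, φ)
      = (((r * Real.cos φ : ℝ) + (r * Real.sin φ : ℝ) * Complex.I : ℂ) ^ k)⁻¹ := by
  have h : ((r * Real.cos φ : ℝ) + (r * Real.sin φ : ℝ) * Complex.I : ℂ)
      = r * Complex.exp (φ * Complex.I) := by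
    rw [Complex.exp_mul_I]; push_cast; ring
  rw [h, mul_pow, mul_inv, polarInvPow, ← Complex.exp_nat_mul, ← Complex.exp_neg]
  congr 2
  ring

theorem hasDerivAt_polarInvPow_radius (k : ℕ) {r : ℝ} (hr : r ≠ 0) (φ : ℝ) :
    HasDerivAt (fun t => polarInvPow k (t, φ)) (-k / r * polarInvPow k (r, φ)) r := by
  have hr' : (r : ℂ) ≠ 0 := by exact_mod_cast hr
  have h := ((((hasDerivAt_id (r : ℂ)).pow k).inv (pow_ne_zero k hr')).mul_const
    (Complex.exp (-Complex.I * k * φ))).comp_ofReal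
  refine h.congr_deriv ?_
  simp only [polarInvPow, id, Pi.pow_apply]
  rcases k with _ | k
  · simp
  · field_simp
    push_cast
    simp [pow_succ]

theorem hasDerivAt_polarInvPow_angle (k : ℕ) (r φ : ℝ) :
    HasDerivAt (fun t => polarInvPow k (r, t)) (-Complex.I * k * polarInvPow k (r, φ)) φ := by
  have h := ((((hasDerivAt_id (φ : ℂ)).const_mul (-Complex.I * k)).cexp).const_mul
    (((r : ℂ) ^ k)⁻¹)).comp_ofReal
  refine h.congr_deriv ?_
  simp only [polarInvPow, id]
  ring

theorem differentiableAt_polarInvPow (k : ℕ) {p : ℝ × ℝ} (hp : p.1 ≠ 0) :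
    DifferentiableAt ℝ (polarInvPow k) p := by
  have h1 : DifferentiableAt ℝ (fun p : ℝ × ℝ => (p.1 : ℂ)) p :=
    Complex.ofRealCLM.differentiableAt.comp p differentiableAt_fst
  have h2 : DifferentiableAt ℝ (fun p : ℝ × ℝ => (p.2 : ℂ)) p :=
    Complex.ofRealCLM.differentiableAt.comp p differentiableAt_snd
  exact ((h1.pow k).inv (pow_ne_zero k (Complex.ofReal_ne_zero.2 hp))).mul
    ((h2.const_mul (-Complex.I * k)).cexp)

/-- The radial component of the field whose divergence is `r Δw / zᵏ`. -/
noncomputable def radialFlux (w : ℝ × ℝ → ℝ) (k : ℕ) (p : ℝ × ℝ) : ℂ :=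
  polarInvPow k p *
    (((p.1 * (Real.cos p.2 * fderiv ℝ w (p.1 * Real.cos p.2, p.1 * Real.sin p.2) (1, 0)
        + Real.sin p.2 * fderiv ℝ w (p.1 * Real.cos p.2, p.1 * Real.sin p.2) (0, 1)) : ℝ) : ℂ)
      + k * (w (p.1 * Real.cos p.2, p.1 * Real.sin p.2) : ℂ))

/-- The angular component of the field whose divergence is `r Δw / zᵏ`. -/
noncomputable def angularFlux (w : ℝ × ℝ → ℝ) (k : ℕ) (p : ℝ × ℝ) : ℂ :=
  polarInvPow k p *
    (((-Real.sin p.2 * fderiv ℝ w (p.1 * Real.cos p.2, p.1 * Real.sin p.2) (1, 0)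
        + Real.cos p.2 * fderiv ℝ w (p.1 * Real.cos p.2, p.1 * Real.sin p.2) (0, 1) : ℝ) : ℂ)
      + Complex.I * k * (w (p.1 * Real.cos p.2, p.1 * Real.sin p.2) : ℂ) / p.1)

theorem ContDiff.differentiable_fderiv_apply {w : ℝ × ℝ → ℝ} (hw : ContDiff ℝ 2 w) (v : ℝ × ℝ) :
    Differentiable ℝ (fun y => fderiv ℝ w y v) :=
  ((hw.fderiv_right (m := 1) (by norm_num)).clm_apply contDiff_const).differentiable (by norm_num)

theorem DifferentiableAt.ofReal_comp_prod {f : ℝ × ℝ → ℝ} {p : ℝ × ℝ}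
    (hf : DifferentiableAt ℝ f p) : DifferentiableAt ℝ (fun p => (f p : ℂ)) p :=
  Complex.ofRealCLM.differentiableAt.comp p hf

theorem differentiable_comp_polar {u : ℝ × ℝ → ℝ} (hu : Differentiable ℝ u) :
    Differentiable ℝ (fun p : ℝ × ℝ => u (p.1 * Real.cos p.2, p.1 * Real.sin p.2)) :=
  hu.comp (by fun_prop)

theorem differentiableAt_radialFlux {w : ℝ × ℝ → ℝ} (hw : ContDiff ℝ 2 w) (k : ℕ) {p : ℝ × ℝ}
    (hp : p.1 ≠ 0) : DifferentiableAt ℝ (radialFlux w k) p := by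
  have h0 := differentiable_comp_polar (hw.differentiable (by norm_num))
  have h1 := differentiable_comp_polar (hw.differentiable_fderiv_apply (1, 0))
  have h2 := differentiable_comp_polar (hw.differentiable_fderiv_apply (0, 1))
  refine (differentiableAt_polarInvPow k hp).mul (.add (.ofReal_comp_prod ?_) ?_)
  · fun_prop
  · exact (h0 p).ofReal_comp_prod.const_mul _

theorem differentiableAt_angularFlux {w : ℝ × ℝ → ℝ} (hw : ContDiff ℝ 2 w) (k : ℕ) {p : ℝ × ℝ}
    (hp : p.1 ≠ 0) : DifferentiableAt ℝ (angularFlux w k) p := by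
  have h0 := differentiable_comp_polar (hw.differentiable (by norm_num))
  have h1 := differentiable_comp_polar (hw.differentiable_fderiv_apply (1, 0))
  have h2 := differentiable_comp_polar (hw.differentiable_fderiv_apply (0, 1))
  refine (differentiableAt_polarInvPow k hp).mul (.add (.ofReal_comp_prod ?_) ?_)
  · fun_prop
  · simp_rw [div_eq_mul_inv]
    exact ((h0 p).ofReal_comp_prod.const_mul _).mul
      ((differentiableAt_fst.ofReal_comp_prod).inv (by exact_mod_cast hp))

theorem fderiv_radialFlux_add_fderiv_angularFlux {w : ℝ × ℝ → ℝ} (hw : ContDiff ℝ 2 w) (k : ℕ) {r : ℝ}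
    (hr : r ≠ 0) (φ : ℝ) :
    fderiv ℝ (radialFlux w k) (r, φ) (1, 0) + fderiv ℝ (angularFlux w k) (r, φ) (0, 1)
      = r • ((lap2 w (r * Real.cos φ, r * Real.sin φ) : ℂ) * polarInvPow k (r, φ)) := by
  have hr' : (r : ℂ) ≠ 0 := by exact_mod_cast hr
  have d0 := hw.differentiable (by norm_num)
  have dx := hw.differentiable_fderiv_apply (1, 0)
  have dy := hw.differentiable_fderiv_apply (0, 1)
  have hR : fderiv ℝ (radialFlux w k) (r, φ) (1, 0)
      = deriv (fun t => radialFlux w k (t, φ)) r :=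
    ((differentiableAt_radialFlux hw k (p := (r, φ)) hr).hasFDerivAt.comp_hasDerivAt r
      ((hasDerivAt_id r).prodMk (hasDerivAt_const r φ))).deriv.symm
  have hA : fderiv ℝ (angularFlux w k) (r, φ) (0, 1)
      = deriv (fun t => angularFlux w k (r, t)) φ :=
    ((differentiableAt_angularFlux hw k (p := (r, φ)) hr).hasFDerivAt.comp_hasDerivAt φ
      ((hasDerivAt_const φ r).prodMk (hasDerivAt_id φ))).deriv.symm
  have eR := (hasDerivAt_polarInvPow_radius k hr φ).mul
    ((((hasDerivAt_id r).mul
      (((hasDerivAt_comp_polar_radius dx r φ).const_mul (Real.cos φ)).add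
        ((hasDerivAt_comp_polar_radius dy r φ).const_mul (Real.sin φ)))).ofReal_comp).add
      ((hasDerivAt_comp_polar_radius d0 r φ).ofReal_comp.const_mul (k : ℂ)))
  have eA := (hasDerivAt_polarInvPow_angle k r φ).mul
    (((((Real.hasDerivAt_sin φ).neg.mul (hasDerivAt_comp_polar_angle dx r φ)).add
        ((Real.hasDerivAt_cos φ).mul (hasDerivAt_comp_polar_angle dy r φ))).ofReal_comp).add
      (((hasDerivAt_comp_polar_angle d0 r φ).ofReal_comp.const_mul (Complex.I * k)).div_const
        (r : ℂ)))
  have eR' : deriv (fun t => radialFlux w k (t, φ)) r = _ := eR.deriv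
  have eA' : deriv (fun t => angularFlux w k (r, t)) φ = _ := eA.deriv
  rw [hR, hA, eR', eA', lap2, Complex.real_smul]
  simp only [id, Pi.add_apply, Pi.mul_apply, Pi.neg_apply]
  have hcs : ((Real.sin φ : ℝ) : ℂ) ^ 2 + ((Real.cos φ : ℝ) : ℂ) ^ 2 = 1 := by
    exact_mod_cast Real.sin_sq_add_cos_sq φ
  have hri : (r : ℂ) * (r : ℂ)⁻¹ = 1 := mul_inv_cancel₀ hr'
  have hI := Complex.I_sq
  generalize polarInvPow k (r, φ) = Q
  generalize (fderiv ℝ (fun y => fderiv ℝ w y (1, 0)) (r * Real.cos φ, r * Real.sin φ)) = X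
  generalize (fderiv ℝ (fun y => fderiv ℝ w y (0, 1)) (r * Real.cos φ, r * Real.sin φ)) = Y
  generalize fderiv ℝ w (r * Real.cos φ, r * Real.sin φ) = L
  generalize w (r * Real.cos φ, r * Real.sin φ) = W
  generalize Real.cos φ = c at *
  generalize Real.sin φ = s at *
  push_cast
  linear_combination (r * Q * (X (1, 0) + Y (0, 1))) * hcs
    + (k * Q * (Complex.I * (-s * L (1, 0) + c * L (0, 1)) - (c * L (1, 0) + s * L (0, 1)))) * hri
    - (k ^ 2 * W * (r : ℂ)⁻¹ * Q) * hI

theorem continuous_comp_polar {u : ℝ × ℝ → ℝ} (hu : Continuous u) :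
    Continuous (fun p : ℝ × ℝ => u (p.1 * Real.cos p.2, p.1 * Real.sin p.2)) :=
  hu.comp (by fun_prop)

theorem norm_cexp_neg_I_mul (k : ℤ) (φ : ℝ) : ‖Complex.exp (-Complex.I * k * φ)‖ = 1 := by
  rw [show -Complex.I * k * φ = ((-k * φ : ℝ) : ℂ) * Complex.I by push_cast; ring]
  exact Complex.norm_exp_ofReal_mul_I _

/-- Differentiation under the integral sign for the angular Fourier coefficients. -/
theorem hasDerivAt_fourierCoef {w : ℝ × ℝ → ℝ} (hw : ContDiff ℝ 2 w) (hsupp : HasCompactSupport w)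
    (k : ℤ) (r : ℝ) :
    HasDerivAt (fourierCoef w k)
      ((1 / (2 * Real.pi)) * ∫ φ in (0 : ℝ)..(2 * Real.pi),
        ((Real.cos φ * fderiv ℝ w (r * Real.cos φ, r * Real.sin φ) (1, 0)
          + Real.sin φ * fderiv ℝ w (r * Real.cos φ, r * Real.sin φ) (0, 1) : ℝ) : ℂ)
            * Complex.exp (-Complex.I * k * φ)) r := by
  have d0 := hw.differentiable (by norm_num)
  have cx := (hw.differentiable_fderiv_apply (1, 0)).continuous
  have cy := (hw.differentiable_fderiv_apply (0, 1)).continuous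
  obtain ⟨A, hA⟩ := (hsupp.fderiv_apply (𝕜 := ℝ) (1, 0)).exists_bound_of_continuous cx
  obtain ⟨B, hB⟩ := (hsupp.fderiv_apply (𝕜 := ℝ) (0, 1)).exists_bound_of_continuous cy
  have hF (x : ℝ) : Continuous (fun φ : ℝ =>
      (w (x * Real.cos φ, x * Real.sin φ) : ℂ) * Complex.exp (-Complex.I * k * φ)) := by
    have : Continuous (fun φ : ℝ => w (x * Real.cos φ, x * Real.sin φ)) :=
      hw.continuous.comp (by fun_prop)
    fun_prop
  suffices h : HasDerivAt (fun x => ∫ φ in (0 : ℝ)..(2 * Real.pi),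
      (w (x * Real.cos φ, x * Real.sin φ) : ℂ) * Complex.exp (-Complex.I * k * φ))
      (∫ φ in (0 : ℝ)..(2 * Real.pi),
        ((Real.cos φ * fderiv ℝ w (r * Real.cos φ, r * Real.sin φ) (1, 0)
          + Real.sin φ * fderiv ℝ w (r * Real.cos φ, r * Real.sin φ) (0, 1) : ℝ) : ℂ)
            * Complex.exp (-Complex.I * k * φ)) r from h.const_mul _
  refine (intervalIntegral.hasDerivAt_integral_of_dominated_loc_of_deriv_le
    (F' := fun x φ => ((Real.cos φ * fderiv ℝ w (x * Real.cos φ, x * Real.sin φ) (1, 0)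
      + Real.sin φ * fderiv ℝ w (x * Real.cos φ, x * Real.sin φ) (0, 1) : ℝ) : ℂ)
        * Complex.exp (-Complex.I * k * φ))
    (s := univ) (bound := fun _ => A + B) Filter.univ_mem
    (.of_forall fun x => (hF x).aestronglyMeasurable) ((hF r).intervalIntegrable _ _)
    ?_ ?_ intervalIntegrable_const ?_).2
  · have h1 : Continuous (fun φ : ℝ => fderiv ℝ w (r * Real.cos φ, r * Real.sin φ) (1, 0)) :=
      cx.comp (g := fun y => fderiv ℝ w y (1, 0)) (by fun_prop)
    have h2 : Continuous (fun φ : ℝ => fderiv ℝ w (r * Real.cos φ, r * Real.sin φ) (0, 1)) :=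
      cy.comp (g := fun y => fderiv ℝ w y (0, 1)) (by fun_prop)
    exact Continuous.aestronglyMeasurable (by fun_prop)
  · refine .of_forall fun φ _ x _ => ?_
    rw [norm_mul, norm_cexp_neg_I_mul, mul_one, Complex.norm_real]
    refine (norm_add_le _ _).trans (add_le_add ?_ ?_)
    · rw [norm_mul]
      exact (mul_le_of_le_one_left (norm_nonneg _) (Real.abs_cos_le_one φ)).trans (hA _)
    · rw [norm_mul]
      exact (mul_le_of_le_one_left (norm_nonneg _) (Real.abs_sin_le_one φ)).trans (hB _)
  · exact .of_forall fun φ _ x _ =>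
      ((hasDerivAt_comp_polar_radius d0 x φ).ofReal_comp).mul_const _

theorem periodic_radialFlux (w : ℝ × ℝ → ℝ) (k : ℕ) (r : ℝ) :
    Function.Periodic (fun φ => radialFlux w k (r, φ)) (2 * Real.pi) := by
  intro φ
  simp only [radialFlux, polarInvPow_eq, Real.cos_add_two_pi, Real.sin_add_two_pi]

theorem integral_radialFlux {w : ℝ × ℝ → ℝ} (hw : ContDiff ℝ 2 w) (hsupp : HasCompactSupport w)
    (k : ℕ) (r : ℝ) :
    ∫ φ in (-Real.pi)..Real.pi, radialFlux w k (r, φ)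
      = 2 * Real.pi * (r : ℂ) ^ (-(k : ℤ)) *
          (r * deriv (fourierCoef w k) r + k * fourierCoef w k r) := by
  have hper := (periodic_radialFlux w k r).intervalIntegral_add_eq (-Real.pi) 0
  rw [show -Real.pi + 2 * Real.pi = Real.pi by ring, zero_add] at hper
  have hpi : (Real.pi : ℂ) ≠ 0 := Complex.ofReal_ne_zero.2 Real.pi_ne_zero
  have h0 : Continuous (fun φ : ℝ => w (r * Real.cos φ, r * Real.sin φ)) :=
    hw.continuous.comp (by fun_prop)
  have h1 : Continuous (fun φ : ℝ => fderiv ℝ w (r * Real.cos φ, r * Real.sin φ) (1, 0)) :=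
    (hw.differentiable_fderiv_apply (1, 0)).continuous.comp
      (g := fun y => fderiv ℝ w y (1, 0)) (by fun_prop)
  have h2 : Continuous (fun φ : ℝ => fderiv ℝ w (r * Real.cos φ, r * Real.sin φ) (0, 1)) :=
    (hw.differentiable_fderiv_apply (0, 1)).continuous.comp
      (g := fun y => fderiv ℝ w y (0, 1)) (by fun_prop)
  rw [hper, (hasDerivAt_fourierCoef hw hsupp k r).deriv, fourierCoef, zpow_neg, zpow_natCast]
  have key : ∀ a b : ℂ, 2 * (Real.pi : ℂ) * ((r : ℂ) ^ k)⁻¹ *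
      (r * (1 / (2 * Real.pi) * a) + k * (1 / (2 * Real.pi) * b))
      = ((r : ℂ) ^ k)⁻¹ * (r * a + k * b) := fun a b => by
    generalize ((r : ℂ) ^ k)⁻¹ = q
    field_simp
  rw [key, ← intervalIntegral.integral_const_mul, ← intervalIntegral.integral_const_mul,
    ← intervalIntegral.integral_add, ← intervalIntegral.integral_const_mul]
  · congr 1 with φ
    simp only [radialFlux, polarInvPow]
    push_cast
    ring
  · exact Continuous.intervalIntegrable (by fun_prop) _ _
  · exact Continuous.intervalIntegrable (by fun_prop) _ _

theorem fderiv_eq_zero_of_notMem_tsupport {w : ℝ × ℝ → ℝ} {x : ℝ × ℝ} (hx : x ∉ tsupport w) :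
    fderiv ℝ w x = 0 := by
  by_contra h
  exact hx (support_fderiv_subset ℝ h)

theorem lap2_eq_zero_of_notMem_tsupport {w : ℝ × ℝ → ℝ} {x : ℝ × ℝ} (hx : x ∉ tsupport w) :
    lap2 w x = 0 := by
  have h (v : ℝ × ℝ) : x ∉ tsupport (fun y => fderiv ℝ w y v) :=
    fun h => hx (tsupport_fderiv_apply_subset ℝ v h)
  simp [lap2, fderiv_eq_zero_of_notMem_tsupport (h _)]

theorem HasCompactSupport.exists_forall_polar_notMem_tsupport {w : ℝ × ℝ → ℝ}
    (hsupp : HasCompactSupport w) (r₀ : ℝ) :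
    ∃ R, r₀ < R ∧ ∀ r φ : ℝ, R ≤ r → (r * Real.cos φ, r * Real.sin φ) ∉ tsupport w := by
  obtain ⟨M, hM⟩ := hsupp.isCompact.isBounded.exists_norm_le
  refine ⟨max (r₀ + 1) (2 * |M| + 1), lt_max_of_lt_left (by linarith), fun r φ hr hmem => ?_⟩
  have h := hM _ hmem
  have hr' := (le_max_right _ _).trans hr
  have h1 : |r * Real.cos φ| ≤ |M| := (norm_fst_le _).trans (h.trans (le_abs_self M))
  have h2 : |r * Real.sin φ| ≤ |M| := (norm_snd_le _).trans (h.trans (le_abs_self M))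
  have h3 := sq_le_sq' (abs_le.1 h1).1 (abs_le.1 h1).2
  have h4 := sq_le_sq' (abs_le.1 h2).1 (abs_le.1 h2).2
  have h5 : r ^ 2 = (r * Real.cos φ) ^ 2 + (r * Real.sin φ) ^ 2 := by
    linear_combination -r ^ 2 * Real.sin_sq_add_cos_sq φ
  nlinarith [abs_nonneg M]

theorem radialFlux_eq_zero_of_notMem_tsupport {w : ℝ × ℝ → ℝ} (k : ℕ) {r φ : ℝ}
    (h : (r * Real.cos φ, r * Real.sin φ) ∉ tsupport w) : radialFlux w k (r, φ) = 0 := by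
  simp [radialFlux, fderiv_eq_zero_of_notMem_tsupport h, image_eq_zero_of_notMem_tsupport h]

theorem ContDiff.continuous_lap2 {w : ℝ × ℝ → ℝ} (hw : ContDiff ℝ 2 w) : Continuous (lap2 w) := by
  have h (v : ℝ × ℝ) : Continuous (fun x => fderiv ℝ (fun y => fderiv ℝ w y v) x v) :=
    (((hw.fderiv_right (m := 1) (by norm_num)).clm_apply contDiff_const).continuous_fderiv
      (by norm_num)).clm_apply continuous_const
  exact (h (1, 0)).add (h (0, 1))

/-- The divergence theorem on a circular shell, in polar coordinates. -/
theorem setIntegral_lap2_mul_polarInvPow {w : ℝ × ℝ → ℝ} (hw : ContDiff ℝ 2 w) (k : ℕ) {r₀ R : ℝ}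
    (hr₀ : 0 < r₀) (hR : r₀ ≤ R) :
    ∫ p in Icc (r₀, -Real.pi) (R, Real.pi),
        p.1 • ((lap2 w (p.1 * Real.cos p.2, p.1 * Real.sin p.2) : ℂ) * polarInvPow k p)
      = (∫ φ in (-Real.pi)..Real.pi, radialFlux w k (R, φ))
        - ∫ φ in (-Real.pi)..Real.pi, radialFlux w k (r₀, φ) := by
  have hpos : ∀ p ∈ Icc (r₀, -Real.pi) (R, Real.pi), p.1 ≠ 0 := fun p hp =>
    (hr₀.trans_le hp.1.1).ne'
  have hpos' : ∀ p ∈ Ioo r₀ R ×ˢ Ioo (-Real.pi) Real.pi \ ∅, p.1 ≠ 0 := fun p hp =>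
    (hr₀.trans hp.1.1.1).ne'
  have heq : EqOn
      (fun p => fderiv ℝ (radialFlux w k) p (1, 0) + fderiv ℝ (angularFlux w k) p (0, 1))
      (fun p => p.1 • ((lap2 w (p.1 * Real.cos p.2, p.1 * Real.sin p.2) : ℂ) * polarInvPow k p))
      (Icc (r₀, -Real.pi) (R, Real.pi)) := fun p hp =>
    fderiv_radialFlux_add_fderiv_angularFlux hw k (hpos p hp) p.2
  have hcont : ContinuousOn
      (fun p : ℝ × ℝ =>
        p.1 • ((lap2 w (p.1 * Real.cos p.2, p.1 * Real.sin p.2) : ℂ) * polarInvPow k p))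
      (Icc (r₀, -Real.pi) (R, Real.pi)) := by
    have h1 := Complex.continuous_ofReal.comp (continuous_comp_polar hw.continuous_lap2)
    have h2 : ContinuousOn (polarInvPow k) (Icc (r₀, -Real.pi) (R, Real.pi)) := fun p hp =>
      (differentiableAt_polarInvPow k (hpos p hp)).continuousAt.continuousWithinAt
    exact continuous_fst.continuousOn.smul (h1.continuousOn.mul h2)
  have hle : ((r₀, -Real.pi) : ℝ × ℝ) ≤ (R, Real.pi) :=
    ⟨hR, by simpa using! (neg_lt_self Real.pi_pos).le⟩
  have hang (x : ℝ) : angularFlux w k (x, Real.pi) = angularFlux w k (x, -Real.pi) := by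
    simp only [angularFlux, polarInvPow_eq, Real.cos_neg, Real.sin_neg, Real.sin_pi, neg_zero]
  have h := integral_divergence_prod_Icc_of_hasFDerivAt_off_countable_of_le
    (radialFlux w k) (angularFlux w k) (fderiv ℝ (radialFlux w k)) (fderiv ℝ (angularFlux w k))
    (r₀, -Real.pi) (R, Real.pi) hle ∅ countable_empty
    (fun p hp => (differentiableAt_radialFlux hw k (hpos p hp)).continuousAt.continuousWithinAt)
    (fun p hp => (differentiableAt_angularFlux hw k (hpos p hp)).continuousAt.continuousWithinAt)
    (fun p hp => (differentiableAt_radialFlux hw k (hpos' p hp)).hasFDerivAt)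
    (fun p hp => (differentiableAt_angularFlux hw k (hpos' p hp)).hasFDerivAt)
    ((hcont.integrableOn_compact isCompact_Icc).congr_fun heq.symm measurableSet_Icc)
  rw [setIntegral_congr_fun measurableSet_Icc heq] at h
  rw [h]
  simp only [hang, sub_self, zero_add]

/-- For `k ≥ 0` and smooth compactly supported `w` on the exterior of the disk,
writing `z = x₁ + i x₂`,
`∫_{|x|>r₀} Δw/z^k dx = − 2π r₀^{−k} (r₀ w_k'(r₀) + k w_k(r₀))`. -/
theorem stmt_10 (r₀ : ℝ) (hr₀ : 0 < r₀) (k : ℕ) (w : ℝ × ℝ → ℝ)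
    (hw : ContDiff ℝ (⊤ : ℕ∞) w) (hsupp : HasCompactSupport w) :
    (∫ x in {x : ℝ × ℝ | r₀ ^ 2 < x.1 ^ 2 + x.2 ^ 2},
        (lap2 w x : ℂ) / ((x.1 : ℂ) + (x.2 : ℂ) * Complex.I) ^ k)
      = -(2 * (Real.pi : ℂ)) * (r₀ : ℂ) ^ (-(k : ℤ)) *
          ((r₀ : ℂ) * deriv (fourierCoef w k) r₀ + (k : ℂ) * fourierCoef w k r₀) := by
  have hw2 : ContDiff ℝ 2 w := hw.of_le (mod_cast le_top : ((2 : ℕ∞) : WithTop ℕ∞) ≤ _)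
  obtain ⟨R, hR, hout⟩ := hsupp.exists_forall_polar_notMem_tsupport r₀
  have hS : MeasurableSet {x : ℝ × ℝ | r₀ ^ 2 < x.1 ^ 2 + x.2 ^ 2} :=
    measurableSet_lt (by fun_prop) (by fun_prop)
  have hshell := setIntegral_lap2_mul_polarInvPow hw2 k hr₀ hR.le
  have hzero : ∫ φ in (-Real.pi)..Real.pi, radialFlux w k (R, φ) = 0 := by
    simp [radialFlux_eq_zero_of_notMem_tsupport k (hout R _ le_rfl)]
  rw [hzero, zero_sub, integral_radialFlux hw2 hsupp] at hshell
  rw [neg_mul, neg_mul, ← hshell, ← integral_indicator hS, ← integral_comp_polarCoord_symm]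
  have hT : MeasurableSet (Ioi r₀ ×ˢ Ioo (-Real.pi) Real.pi) :=
    measurableSet_Ioi.prod measurableSet_Ioo
  trans ∫ p in Ioi r₀ ×ˢ Ioo (-Real.pi) Real.pi,
      p.1 • ((lap2 w (p.1 * Real.cos p.2, p.1 * Real.sin p.2) : ℂ) * polarInvPow k p)
  · rw [← integral_indicator hT, ← integral_indicator polarCoord.open_target.measurableSet]
    congr 1 with p
    by_cases hp : p ∈ polarCoord.target
    · have hp1 : 0 < p.1 := hp.1
      have hsq : (p.1 * Real.cos p.2) ^ 2 + (p.1 * Real.sin p.2) ^ 2 = p.1 ^ 2 := by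
        linear_combination p.1 ^ 2 * Real.sin_sq_add_cos_sq p.2
      have hiff : (p.1 * Real.cos p.2, p.1 * Real.sin p.2)
          ∈ {x : ℝ × ℝ | r₀ ^ 2 < x.1 ^ 2 + x.2 ^ 2} ↔ r₀ < p.1 := by
        rw [mem_ofPred_eq, hsq, sq_lt_sq₀ hr₀.le hp1.le]
      rw [indicator_of_mem hp, polarCoord_symm_apply]
      by_cases h : r₀ < p.1
      · rw [indicator_of_mem (hiff.2 h), indicator_of_mem (mk_mem_prod h hp.2 : p ∈ Ioi r₀ ×ˢ Ioo (-Real.pi) Real.pi),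
          div_eq_mul_inv, ← Prod.mk.eta (p := p), polarInvPow_eq]
      · rw [indicator_of_notMem (mt hiff.1 h), indicator_of_notMem (fun h' => h h'.1), smul_zero]
    · rw [indicator_of_notMem hp, indicator_of_notMem
        (fun h => hp ⟨hr₀.trans (mem_Ioi.1 h.1), h.2⟩)]
  · trans ∫ p in Ioc r₀ R ×ˢ Ioo (-Real.pi) Real.pi,
        p.1 • ((lap2 w (p.1 * Real.cos p.2, p.1 * Real.sin p.2) : ℂ) * polarInvPow k p)
    · refine setIntegral_eq_of_subset_of_forall_sdiff_eq_zero hT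
        (prod_mono Ioc_subset_Ioi_self subset_rfl) fun p hp => ?_
      have hRp : R ≤ p.1 := by
        by_contra! h
        exact hp.2 ⟨⟨hp.1.1, h.le⟩, hp.1.2⟩
      rw [lap2_eq_zero_of_notMem_tsupport (hout p.1 p.2 hRp)]
      simp
    · rw [← Icc_prod_Icc]
      exact setIntegral_congr_set
        (Measure.set_prod_ae_eq Ioc_ae_eq_Icc Ioo_ae_eq_Icc)
end
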